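/- Let k be a commutative ring, A and B small additive categories, Φ : A → B an additive functor, Φ_* : (A, Mod_k) → (B, Mod_k) the left Kan extension along Φ, and L_i(Φ_*) its left derived functors. If F : A → Mod_k is polynomial of degree at most d (i.e. its (d+1)-st cross-effect cr_{d+1}(F) vanishes), then for every i ≥ 0 the functor L_i(Φ_*)(F) : B → Mod_k is polynomial of degree at most d. -/

import Mathlib

/-!
Statement 12: If `Φ : A → B` is an additive functor between small additive categories and
`F : A → Mod_k` is polynomial of degree at most `d` (its `(d+1)`-st cross-effect vanishes),
then each left derived functor `L_i(Φ_*)(F)` of the left Kan extension of `F` along `Φ` is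
polynomial of degree at most `d`.
-/

open CategoryTheory CategoryTheory.Limits

universe u

/-- The map `F(x₁ ⊕ ⋯ ⊕ x_d) ⟶ F(x₁ ⊕ ⋯ ⊕ x_{i-1} ⊕ x_{i+1} ⊕ ⋯ ⊕ x_d)` induced by the
biproduct projections deleting the `i`-th summand. -/
noncomputable def deleteSummand {A : Type u} [SmallCategory A] [Preadditive A]
    [HasFiniteBiproducts A] {d : ℕ} (x : Fin d → A) (i : Fin d) :
    (⨁ x) ⟶ ⨁ fun j : {j : Fin d // j ≠ i} => x j.1 :=
  biproduct.lift fun j => biproduct.π x j.1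

/-- A functor `F : A ⥤ Mod_k` is polynomial of degree at most `d` if its `(d+1)`-st
cross-effect vanishes, i.e. for every family `x : Fin (d+1) → A` the intersection of the
kernels of the maps `F(⊕ x) ⟶ F(⊕ x delete i)` induced by the biproduct projections deleting
one summand is zero. -/
def IsPolynomialOfDegLE {A : Type u} [SmallCategory A] [Preadditive A]
    [HasFiniteBiproducts A] {k : Type u} [CommRing k]
    (F : A ⥤ ModuleCat.{u} k) (d : ℕ) : Prop :=
  ∀ (x : Fin (d + 1) → A) (m : F.obj (⨁ x)),
    (∀ i : Fin (d + 1), F.map (deleteSummand x i) m = 0) → m = 0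

section Helpers

open CategoryTheory.Functor

/-- The functor `a ↦ a ⊕ ⋯ ⊕ a` (`n` summands). -/
noncomputable abbrev powFunctor (A : Type u) [SmallCategory A] [Preadditive A]
    [HasFiniteBiproducts A] (n : ℕ) : A ⥤ A where
  obj a := ⨁ fun _ : Fin n => a
  map f := biproduct.map fun _ => f
  map_id _ := by ext; simp
  map_comp _ _ := by ext; simp

/-- The partial diagonal `a ⟶ a ⊕ ⋯ ⊕ a`, with zero components at the indices in `S`. -/
noncomputable def partialDiag {A : Type u} [SmallCategory A] [Preadditive A]
    [HasFiniteBiproducts A] {n : ℕ} (S : Finset (Fin n)) (a : A) :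
    a ⟶ ⨁ fun _ : Fin n => a :=
  biproduct.lift fun j => if j ∈ S then 0 else 𝟙 a

lemma partialDiag_naturality {A : Type u} [SmallCategory A] [Preadditive A]
    [HasFiniteBiproducts A] {n : ℕ} (S : Finset (Fin n)) {a b : A} (f : a ⟶ b) :
    partialDiag S a ≫ (biproduct.map fun _ => f) = f ≫ partialDiag S b := by
  apply biproduct.hom_ext
  intro j
  by_cases h : j ∈ S <;> simp [partialDiag, powFunctor, h]

/-- The deviation, as a natural transformation `F ⟶ F ∘ D`, natural in `F`. -/
noncomputable def deviation (A : Type u) [SmallCategory A] [Preadditive A]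
    [HasFiniteBiproducts A] (k : Type u) [CommRing k] (n : ℕ) :
    𝟭 (A ⥤ ModuleCat.{u} k) ⟶ (whiskeringLeft A A (ModuleCat.{u} k)).obj (powFunctor A n) where
  app F :=
    { app := fun a => ∑ S : Finset (Fin n), ((-1 : ℤ) ^ S.card) • F.map (partialDiag S a)
      naturality := fun a b f => by
        dsimp
        rw [Preadditive.comp_sum, Preadditive.sum_comp]
        refine Finset.sum_congr rfl fun S _ => ?_
        rw [Preadditive.comp_zsmul, Preadditive.zsmul_comp, ← F.map_comp, ← F.map_comp,
          partialDiag_naturality] }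
  naturality F G φ := by
    ext a : 2
    simp [Preadditive.comp_sum, Preadditive.sum_comp]

lemma deviation_app_app {A : Type u} [SmallCategory A] [Preadditive A]
    [HasFiniteBiproducts A] {k : Type u} [CommRing k] (n : ℕ) (F : A ⥤ ModuleCat.{u} k) (a : A) :
    ((deviation A k n).app F).app a =
      ∑ S : Finset (Fin n), ((-1 : ℤ) ^ S.card) • F.map (partialDiag S a) := rfl

lemma deviation_eq_zero {A : Type u} [SmallCategory A] [Preadditive A]
    [HasFiniteBiproducts A] {k : Type u} [CommRing k] {d : ℕ} (F : A ⥤ ModuleCat.{u} k)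
    (hF : IsPolynomialOfDegLE F d) : (deviation A k (d + 1)).app F = 0 := by
  ext a m : 4
  refine hF (fun _ => a) _ fun i => ?_
  have key : ((deviation A k (d + 1)).app F).app a ≫
      F.map (deleteSummand (fun _ : Fin (d + 1) => a) i) = 0 := by
    rw [deviation_app_app, Preadditive.sum_comp]
    refine Finset.sum_involution (fun S _ => symmDiff S {i}) ?_ ?_ ?_ ?_
    · intro S _
      have h1 : partialDiag (symmDiff S {i}) a ≫ deleteSummand (fun _ : Fin (d + 1) => a) i
          = partialDiag S a ≫ deleteSummand (fun _ : Fin (d + 1) => a) i := by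
        apply biproduct.hom_ext
        rintro ⟨j, hj⟩
        simp [deleteSummand, partialDiag, Finset.mem_symmDiff, hj]
      have h2 : (-1 : ℤ) ^ (symmDiff S {i}).card = - (-1 : ℤ) ^ S.card := by
        by_cases hi : i ∈ S
        · have : symmDiff S {i} = S.erase i := by
            ext j; simp only [Finset.mem_symmDiff, Finset.mem_singleton, Finset.mem_erase]
            grind
          rw [this, ← Finset.card_erase_add_one hi]
          ring
        · have : symmDiff S {i} = insert i S := by
            ext j; simp only [Finset.mem_symmDiff, Finset.mem_singleton, Finset.mem_insert]
            grind
          rw [this, Finset.card_insert_of_notMem hi]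
          ring
      rw [Preadditive.zsmul_comp, Preadditive.zsmul_comp, ← F.map_comp, ← F.map_comp, h1, h2,
        neg_smul, add_neg_cancel]
    · intro S _ _ h
      have := congrArg (i ∈ ·) h
      simp [Finset.mem_symmDiff] at this
    · simp
    · intro S _
      simp [symmDiff_assoc]
  exact congrArg (fun f => f.hom m) key

lemma isPolynomial_of_deviation {A : Type u} [SmallCategory A] [Preadditive A]
    [HasFiniteBiproducts A] {k : Type u} [CommRing k] {d : ℕ} (F : A ⥤ ModuleCat.{u} k)
    (hF : (deviation A k (d + 1)).app F = 0) : IsPolynomialOfDegLE F d := by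
  intro x m hm
  let t : (⨁ fun _ : Fin (d + 1) => ⨁ x) ⟶ ⨁ x := biproduct.map fun j => biproduct.π x j
  have h0 : (∑ S : Finset (Fin (d + 1)), ((-1 : ℤ) ^ S.card) •
      F.map (partialDiag S (⨁ x) ≫ t)) = 0 := by
    have := congrArg (fun φ => φ.app (⨁ x) ≫ F.map t) hF
    simpa [deviation_app_app, Preadditive.sum_comp] using this
  have h1 : ∀ S : Finset (Fin (d + 1)), S ≠ ∅ → F.map (partialDiag S (⨁ x) ≫ t) m = 0 := by
    intro S hS
    obtain ⟨i, hi⟩ := Finset.nonempty_iff_ne_empty.mpr hS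
    have : partialDiag S (⨁ x) ≫ t = deleteSummand x i ≫
        biproduct.lift (fun j => if h : j ∈ S then 0 else
          biproduct.π (fun j : {j : Fin (d + 1) // j ≠ i} => x j.1)
            ⟨j, fun e => h (e ▸ hi)⟩) := by
      apply biproduct.hom_ext
      intro j
      by_cases h : j ∈ S <;> simp [partialDiag, t, deleteSummand, h]
    rw [this, F.map_comp, ModuleCat.comp_apply, hm i, map_zero]
  have h2 : partialDiag ∅ (⨁ x) ≫ t = 𝟙 _ := by
    apply biproduct.hom_ext
    intro j
    simp [partialDiag, t]
  have h3 := congrArg (fun f => f.hom m) h0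
  simp only [ModuleCat.hom_sum, ModuleCat.hom_zsmul, LinearMap.sum_apply,
    LinearMap.smul_apply] at h3
  rw [Finset.sum_eq_single ∅] at h3
  · rw [h2] at h3
    simpa using h3
  · intro S _ hS
    have := h1 S hS
    erw [this]
    simp
  · simp

/-- A natural transformation to an exact functor which vanishes at `X` is null-homotopic
on projective resolutions of `X`. -/
noncomputable def nullHomotopy {C : Type*} [Category* C] [Abelian C] (W : C ⥤ C) [W.Additive]
    [W.PreservesHomology] (τ : 𝟭 C ⟶ W) {X : C}
    (P : ProjectiveResolution X) (hX : τ.app X = 0)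
    (f : P.complex ⟶ (W.mapHomologicalComplex _).obj P.complex)
    (hf : ∀ n, f.f n = τ.app (P.complex.X n)) : Homotopy f 0 := by
  have e0 := P.exact₀.map W
  have es := fun n => (P.exact_succ n).map W
  have comm : ∀ {Y Z : C} (g : Y ⟶ Z), (τ.app Y : Y ⟶ W.obj Y) ≫ W.map g = g ≫ τ.app Z :=
    fun g => (τ.naturality g).symm
  let φ : ∀ n, P.complex.X n ⟶ W.obj (P.complex.X n) := fun n => τ.app (P.complex.X n)
  have hX' : τ.app (((ChainComplex.single₀ C).obj X).X 0) = 0 := hX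
  have c0 : φ 0 ≫ W.map (P.π.f 0) = 0 := by
    rw [comm, hX', comp_zero]
  have dd : ∀ n, P.complex.d (n + 2) (n + 1) ≫ P.complex.d (n + 1) n = 0 := fun n => by simp
  let s0 : P.complex.X 0 ⟶ W.obj (P.complex.X 1) := e0.liftFromProjective (φ 0) c0
  have hs0 : s0 ≫ W.map (P.complex.d 1 0) = φ 0 := e0.liftFromProjective_comp _ _
  have c1 : (φ 1 - P.complex.d 1 0 ≫ s0) ≫ W.map (P.complex.d 1 0) = 0 := by
    rw [Preadditive.sub_comp, Category.assoc, hs0, comm, sub_self]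
  let s1 : P.complex.X 1 ⟶ W.obj (P.complex.X 2) := (es 0).liftFromProjective _ c1
  have hs1 : s1 ≫ W.map (P.complex.d 2 1) = φ 1 - P.complex.d 1 0 ≫ s0 :=
    (es 0).liftFromProjective_comp _ _
  refine Homotopy.mkInductive _ s0 ((hf 0).trans hs0.symm) s1 ((hf 1).trans ?_) ?_
  · change φ 1 = P.complex.d 1 0 ≫ s0 + s1 ≫ W.map (P.complex.d 2 1)
    rw [hs1, add_sub_cancel]
  · rintro n ⟨g₀, g₁, w⟩
    let g : P.complex.X n ⟶ W.obj (P.complex.X (n + 1)) := g₀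
    let g' : P.complex.X (n + 1) ⟶ W.obj (P.complex.X (n + 2)) := g₁
    have w' : φ (n + 1) = P.complex.d (n + 1) n ≫ g +
      g' ≫ W.map (P.complex.d (n + 2) (n + 1)) := (hf (n + 1)).symm.trans w
    have c : (φ (n + 2) - P.complex.d (n + 2) (n + 1) ≫ g') ≫
        W.map (P.complex.d (n + 2) (n + 1)) = 0 := by
      rw [Preadditive.sub_comp, Category.assoc, comm]
      change P.complex.d (n + 2) (n + 1) ≫ φ (n + 1) - _ = 0
      rw [w', Preadditive.comp_add, ← Category.assoc, dd, zero_comp, zero_add]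
      exact sub_self _
    refine ⟨(es (n + 1)).liftFromProjective _ c, (hf (n + 2)).trans ?_⟩
    have h := (es (n + 1)).liftFromProjective_comp _ c
    exact ((congrArg (fun z => P.complex.d (n + 2) (n + 1) ≫ g' + z) h).trans
      (add_sub_cancel _ _)).symm

/-- The comparison `Φ (a ⊕ ⋯ ⊕ a) ⟶ Φ a ⊕ ⋯ ⊕ Φ a`. -/
noncomputable def powComparison {A B : Type u} [SmallCategory A] [SmallCategory B]
    [Preadditive A] [Preadditive B] [HasFiniteBiproducts A] [HasFiniteBiproducts B]
    (Φ : A ⥤ B) [Φ.Additive] (n : ℕ) :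
    powFunctor A n ⋙ Φ ⟶ Φ ⋙ powFunctor B n where
  app a := biproduct.lift fun j => Φ.map (biproduct.π (fun _ : Fin n => a) j)
  naturality a b f := by
    apply biproduct.hom_ext
    intro j
    dsimp
    rw [Category.assoc, Category.assoc, biproduct.lift_π, biproduct.map_π,
      biproduct.lift_π_assoc, ← Φ.map_comp, ← Φ.map_comp, biproduct.map_π]

lemma partialDiag_powComparison {A B : Type u} [SmallCategory A] [SmallCategory B]
    [Preadditive A] [Preadditive B] [HasFiniteBiproducts A] [HasFiniteBiproducts B]
    (Φ : A ⥤ B) [Φ.Additive] {n : ℕ} (S : Finset (Fin n)) (a : A) :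
    Φ.map (partialDiag S a) ≫
      (biproduct.lift fun j => Φ.map (biproduct.π (fun _ : Fin n => a) j)) =
      partialDiag S (Φ.obj a) := by
  apply biproduct.hom_ext
  intro j
  by_cases h : j ∈ S <;> simp [partialDiag, h, ← Φ.map_comp]

section Lan

variable {A B : Type u} [SmallCategory A] [SmallCategory B]
    [Preadditive A] [Preadditive B] [HasFiniteBiproducts A] [HasFiniteBiproducts B]
    {k : Type u} [CommRing k]
    (Φ : A ⥤ B) [Φ.Additive]
    [∀ F : A ⥤ ModuleCat.{u} k, Φ.HasLeftKanExtension F]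

/-- The unit of the left Kan extension, evaluated at an object. -/
noncomputable def lanη (F : A ⥤ ModuleCat.{u} k) (a : A) :
    F.obj a ⟶ (Φ.lan.obj F).obj (Φ.obj a) := (Φ.lanUnit.app F).app a

lemma lanη_map (F : A ⥤ ModuleCat.{u} k) {a b : A} (f : a ⟶ b) :
    F.map f ≫ lanη Φ F b = lanη Φ F a ≫ (Φ.lan.obj F).map (Φ.map f) :=
  (Φ.lanUnit.app F).naturality f

lemma lanη_map_assoc (F : A ⥤ ModuleCat.{u} k) {a b : A} (f : a ⟶ b) {Z : ModuleCat.{u} k}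
    (h : (Φ.lan.obj F).obj (Φ.obj b) ⟶ Z) :
    F.map f ≫ lanη Φ F b ≫ h = lanη Φ F a ≫ (Φ.lan.obj F).map (Φ.map f) ≫ h := by
  rw [← Category.assoc, lanη_map, Category.assoc]

lemma lanη_nat {F G : A ⥤ ModuleCat.{u} k} (φ : F ⟶ G) (a : A) :
    lanη Φ F a ≫ (Φ.lan.map φ).app (Φ.obj a) = φ.app a ≫ lanη Φ G a :=
  (congr_app (Φ.lanUnit.naturality φ) a).symm

lemma lanη_nat_assoc {F G : A ⥤ ModuleCat.{u} k} (φ : F ⟶ G) (a : A) {Z : ModuleCat.{u} k}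
    (h : (Φ.lan.obj G).obj (Φ.obj a) ⟶ Z) :
    lanη Φ F a ≫ (Φ.lan.map φ).app (Φ.obj a) ≫ h = φ.app a ≫ lanη Φ G a ≫ h := by
  rw [← Category.assoc, lanη_nat, Category.assoc]

lemma lan_hom_ext {F : A ⥤ ModuleCat.{u} k} {G : B ⥤ ModuleCat.{u} k}
    (α β : Φ.lan.obj F ⟶ G)
    (h : ∀ a, lanη Φ F a ≫ α.app (Φ.obj a) = lanη Φ F a ≫ β.app (Φ.obj a)) : α = β := by
  apply Functor.hom_ext_of_isLeftKanExtension (Φ.lan.obj F) (Φ.lanUnit.app F)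
  ext a : 2
  exact h a

/-- The map `F ∘ D ⟶ Φ^* (D^* (Φ_* F))` whose adjoint is `lanPow`. -/
noncomputable def lanPowAux (n : ℕ) (F : A ⥤ ModuleCat.{u} k) :
    powFunctor A n ⋙ F ⟶ Φ ⋙ (powFunctor B n ⋙ (Φ.lan.obj F)) where
  app a := lanη Φ F (⨁ fun _ : Fin n => a) ≫
    (Φ.lan.obj F).map (biproduct.lift fun j => Φ.map (biproduct.π (fun _ : Fin n => a) j))
  naturality a b f := by
    have h2 := (powComparison Φ n).naturality f
    dsimp [powComparison] at h2 ⊢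
    rw [lanη_map_assoc, Category.assoc, ← Functor.map_comp, h2, ← Functor.map_comp]

/-- The components of `lanPow`. -/
noncomputable def lanPowApp (n : ℕ) (F : A ⥤ ModuleCat.{u} k) :
    Φ.lan.obj (powFunctor A n ⋙ F) ⟶ powFunctor B n ⋙ Φ.lan.obj F :=
  (Φ.lan.obj (powFunctor A n ⋙ F)).descOfIsLeftKanExtension
    (Φ.lanUnit.app (powFunctor A n ⋙ F)) _ (lanPowAux Φ n F)

lemma lanη_lanPowApp (n : ℕ) (F : A ⥤ ModuleCat.{u} k) (a : A) :
    lanη Φ (powFunctor A n ⋙ F) a ≫ (lanPowApp Φ n F).app (Φ.obj a) =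
      lanη Φ F (⨁ fun _ : Fin n => a) ≫ (Φ.lan.obj F).map
        (biproduct.lift fun j => Φ.map (biproduct.π (fun _ : Fin n => a) j)) :=
  Functor.descOfIsLeftKanExtension_fac_app (Φ.lan.obj (powFunctor A n ⋙ F))
    (Φ.lanUnit.app (powFunctor A n ⋙ F)) _ (lanPowAux Φ n F) a

lemma lanη_lanPowApp_assoc (n : ℕ) (F : A ⥤ ModuleCat.{u} k) (a : A) {Z : ModuleCat.{u} k}
    (h : (Φ.lan.obj F).obj (⨁ fun _ : Fin n => Φ.obj a) ⟶ Z) :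
    lanη Φ (powFunctor A n ⋙ F) a ≫ (lanPowApp Φ n F).app (Φ.obj a) ≫ h =
      lanη Φ F (⨁ fun _ : Fin n => a) ≫ (Φ.lan.obj F).map
        (biproduct.lift fun j => Φ.map (biproduct.π (fun _ : Fin n => a) j)) ≫ h := by
  have := congrArg (fun z => z ≫ h) (lanη_lanPowApp Φ n F a)
  simpa only [Category.assoc] using this

/-- The natural map `Φ_* (F ∘ D) ⟶ (Φ_* F) ∘ D`. -/
noncomputable def lanPow (n : ℕ) :
    (whiskeringLeft A A (ModuleCat.{u} k)).obj (powFunctor A n) ⋙ Φ.lan ⟶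
      Φ.lan ⋙ (whiskeringLeft B B (ModuleCat.{u} k)).obj (powFunctor B n) where
  app F := lanPowApp Φ n F
  naturality F G φ := by
    refine lan_hom_ext Φ (F := powFunctor A n ⋙ F) _ _ fun a => ?_
    have h1 := lanη_nat_assoc Φ (whiskerLeft (powFunctor A n) φ) a
      ((lanPowApp Φ n G).app (Φ.obj a))
    refine h1.trans ?_
    rw [lanη_lanPowApp]
    refine Eq.trans ?_ (lanη_lanPowApp_assoc Φ n F a
      ((Φ.lan.map φ).app (⨁ fun _ : Fin n => Φ.obj a))).symm
    rw [(Φ.lan.map φ).naturality, lanη_nat_assoc]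
    rfl

lemma lan_deviation (n : ℕ) (F : A ⥤ ModuleCat.{u} k) :
    (deviation B k n).app (Φ.lan.obj F) =
      Φ.lan.map ((deviation A k n).app F) ≫ (lanPow Φ n).app F := by
  refine lan_hom_ext Φ _ _ fun a => ?_
  refine Eq.trans ?_ (lanη_nat_assoc Φ ((deviation A k n).app F) a
      ((lanPowApp Φ n F).app (Φ.obj a))).symm
  refine Eq.trans ?_ (congrArg (fun z => ((deviation A k n).app F).app a ≫ z)
    (lanη_lanPowApp Φ n F a)).symm
  rw [deviation_app_app, deviation_app_app]
  rw [Preadditive.comp_sum, Preadditive.sum_comp]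
  refine Finset.sum_congr rfl fun S _ => ?_
  rw [Preadditive.comp_zsmul, Preadditive.zsmul_comp, lanη_map_assoc, ← Functor.map_comp,
    partialDiag_powComparison]

lemma deviation_homology_zero [EnoughProjectives (A ⥤ ModuleCat.{u} k)]
    [(Φ.lan : (A ⥤ ModuleCat.{u} k) ⥤ (B ⥤ ModuleCat.{u} k)).Additive]
    (F : A ⥤ ModuleCat.{u} k) (n : ℕ) (hF : (deviation A k n).app F = 0) (i : ℕ)
    (P : ProjectiveResolution F) :
    (deviation B k n).app (((Φ.lan.mapHomologicalComplex _).obj P.complex).homology i) = 0 := by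
  let W := (whiskeringLeft A A (ModuleCat.{u} k)).obj (powFunctor A n)
  let W' := (whiskeringLeft B B (ModuleCat.{u} k)).obj (powFunctor B n)
  let K := (Φ.lan.mapHomologicalComplex (ComplexShape.down ℕ)).obj P.complex
  let f : P.complex ⟶ (W.mapHomologicalComplex _).obj P.complex :=
    { f := fun j => (deviation A k n).app (P.complex.X j)
      comm' := fun p q _ => ((deviation A k n).naturality (P.complex.d p q)).symm }
  have h := nullHomotopy W (deviation A k n) P hF f fun _ => rfl
  let σ : (Φ.lan.mapHomologicalComplex _).obj ((W.mapHomologicalComplex _).obj P.complex) ⟶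
      (W'.mapHomologicalComplex _).obj K :=
    { f := fun j => (lanPow Φ n).app (P.complex.X j)
      comm' := fun p q _ => ((lanPow Φ n).naturality (P.complex.d p q)).symm }
  have h' := (Φ.lan.mapHomotopy h).compRight σ
  let g : K ⟶ (W'.mapHomologicalComplex _).obj K :=
    { f := fun j => (deviation B k n).app (K.X j)
      comm' := fun p q _ => ((deviation B k n).naturality (K.d p q)).symm }
  have hg : (Φ.lan.mapHomologicalComplex _).map f ≫ σ = g := by
    ext j : 1
    exact (lan_deviation Φ n (P.complex.X j)).symm
  have hz : HomologicalComplex.homologyMap g i = 0 := by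
    rw [← hg, h'.homologyMap_eq]
    simp
  have := NatTrans.app_homology (deviation B k n) (K.sc i)
  refine this.trans ?_
  have hz' : ShortComplex.homologyMap ((K.sc i).mapNatTrans (deviation B k n)) = 0 := hz
  rw [hz']
  exact (congrArg (fun z => _ ≫ z) zero_comp).trans comp_zero

end Lan

end Helpers

theorem leftDerived_lan_polynomial
    {A B : Type u} [SmallCategory A] [SmallCategory B]
    [Preadditive A] [Preadditive B] [HasFiniteBiproducts A] [HasFiniteBiproducts B]
    {k : Type u} [CommRing k]
    (Φ : A ⥤ B) [Φ.Additive]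
    [∀ F : A ⥤ ModuleCat.{u} k, Φ.HasLeftKanExtension F]
    [EnoughProjectives (A ⥤ ModuleCat.{u} k)]
    [(Φ.lan : (A ⥤ ModuleCat.{u} k) ⥤ (B ⥤ ModuleCat.{u} k)).Additive]
    (F : A ⥤ ModuleCat.{u} k) (d : ℕ) (hF : IsPolynomialOfDegLE F d) (i : ℕ) :
    IsPolynomialOfDegLE
      (((Φ.lan : (A ⥤ ModuleCat.{u} k) ⥤ (B ⥤ ModuleCat.{u} k)).leftDerived i).obj F) d := by
  apply isPolynomial_of_deviation
  let P := projectiveResolution F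
  have h := deviation_homology_zero Φ F (d + 1) (deviation_eq_zero F hF) i P
  let e := P.isoLeftDerivedObj
    (Φ.lan : (A ⥤ ModuleCat.{u} k) ⥤ (B ⥤ ModuleCat.{u} k)) i
  have hn := (deviation B k (d + 1)).naturality e.inv
  have hh : e.inv ≫ (deviation B k (d + 1)).app _ = 0 := by
    refine hn.trans ?_
    exact (congrArg (fun z => z ≫ _) h).trans zero_comp
  rw [← cancel_epi e.inv]
  exact hh.trans comp_zero.symm
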